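/- arXiv:1912.08906 — 2 statements merged into one kernel-verified Lean document; each statement's English description precedes it below -/
import Mathlib

section
/- Let p be an odd prime, let G be a quasi-powerful p-group and let i be a nonnegative integer. Suppose x, y ∈ G satisfy x^{p^{i+1}} = 1 and y^{p^i} = 1. Then for all nonnegative integers j, k: if j + k ≤ i then [x^{p^j}, y^{p^k}]^{p^{i-j-k}} = 1, and if j + k > i then [x^{p^j}, y^{p^k}] = 1. (That is, o([x^{p^j}, y^{p^k}]) ≤ p^{i-j-k}, with the convention that an order bound p^m with m < 0 means the element is trivial.) -/
/-- The subgroup of `G` generated by all `n`-th powers. -/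
def powSubgroup (G : Type*) [Group G] (n : ℕ) : Subgroup G :=
  Subgroup.closure {x : G | ∃ g : G, g ^ n = x}

/-- `Ω_k`-type subgroup: generated by all elements whose `n`-th power is trivial. -/
def omegaSubgroup (G : Type*) [Group G] (n : ℕ) : Subgroup G :=
  Subgroup.closure {g : G | g ^ n = 1}

/-- A group is powerful (for a prime `p`) if `[G,G] ≤ G^p`. -/
def IsPowerful (p : ℕ) (G : Type*) [Group G] : Prop :=
  commutator G ≤ powSubgroup G p

/-- A group is quasi-powerful (for a prime `p`) if `G/Z(G)` is powerful. -/
def IsQuasiPowerful (p : ℕ) (G : Type*) [Group G] : Prop :=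
  IsPowerful p (G ⧸ Subgroup.center G)

/-- The commutator `[x,y] = x⁻¹y⁻¹xy`. -/
def pcomm {G : Type*} [Group G] (a b : G) : G := a⁻¹ * b⁻¹ * a * b

open scoped commutatorElement

/-- The lower exponent-`p` central series, starting at `⊤` in degree `0`. -/
def lowerExponentSeries (p : ℕ) (G : Type*) [Group G] : ℕ → Subgroup G
  | 0 => ⊤
  | k + 1 =>
    Subgroup.normalClosure {x | ∃ a ∈ lowerExponentSeries p G k, a ^ p = x} ⊔
      ⁅lowerExponentSeries p G k, ⊤⁆

section CommutatorCalculus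

variable {G : Type*} [Group G]

theorem pow_mul_eq_of_commute_commutator {a b : G} (ha : Commute ⁅b, a⁆ a)
    (hb : Commute ⁅b, a⁆ b) (n : ℕ) : b ^ n * a = a * b ^ n * ⁅b, a⁆ ^ n := by
  have hba : b * a = a * b * ⁅b, a⁆ := by
    rw [mul_assoc, ← hb.eq, ← mul_assoc, ← ha.eq, commutatorElement_def]
    group
  induction n with
  | zero => simp
  | succ n ih =>
    calc b ^ (n + 1) * a = b ^ n * (b * a) := by rw [pow_succ, mul_assoc]
      _ = (b ^ n * a) * (b * ⁅b, a⁆) := by rw [hba]; simp only [mul_assoc]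
      _ = a * b ^ n * (⁅b, a⁆ ^ n * b) * ⁅b, a⁆ := by rw [ih]; simp only [mul_assoc]
      _ = a * b ^ (n + 1) * ⁅b, a⁆ ^ (n + 1) := by
        rw [(hb.pow_left n).eq, pow_succ, pow_succ]; simp only [mul_assoc]

theorem mul_pow_of_commute_commutator {a b : G} (ha : Commute ⁅b, a⁆ a)
    (hb : Commute ⁅b, a⁆ b) (n : ℕ) :
    (a * b) ^ n = a ^ n * b ^ n * ⁅b, a⁆ ^ n.choose 2 := by
  induction n with
  | zero => simp
  | succ n ih =>
    have hc : (n + 1).choose 2 = n + n.choose 2 := by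
      rw [Nat.choose_succ_succ' n 1, Nat.choose_one_right]
    calc (a * b) ^ (n + 1) = a ^ n * b ^ n * (⁅b, a⁆ ^ n.choose 2 * (a * b)) := by
          rw [pow_succ, ih]; simp only [mul_assoc]
      _ = a ^ n * (b ^ n * a) * b * ⁅b, a⁆ ^ n.choose 2 := by
          rw [((ha.mul_right hb).pow_left _).eq]; simp only [mul_assoc]
      _ = a ^ n * a * b ^ n * (⁅b, a⁆ ^ n * b) * ⁅b, a⁆ ^ n.choose 2 := by
          rw [pow_mul_eq_of_commute_commutator ha hb]; simp only [mul_assoc]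
      _ = a ^ (n + 1) * b ^ (n + 1) * ⁅b, a⁆ ^ (n + 1).choose 2 := by
          rw [(hb.pow_left n).eq, hc, pow_add _ n (n.choose 2), pow_succ a, pow_succ b]
          simp only [mul_assoc]

theorem mul_pow_prime_of_commute_commutator {p : ℕ} (hp : p.Prime) (hodd : Odd p) {a b : G}
    (ha : Commute ⁅b, a⁆ a) (hb : Commute ⁅b, a⁆ b) (hc : ⁅b, a⁆ ^ p = 1) :
    (a * b) ^ p = a ^ p * b ^ p := by
  have h2 : 2 < p := by
    have := hp.two_le
    rcases hodd with ⟨m, rfl⟩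
    omega
  obtain ⟨m, hm⟩ := hp.dvd_choose_self two_ne_zero h2
  rw [mul_pow_of_commute_commutator ha hb, hm, pow_mul, hc, one_pow, mul_one]

theorem commutator_commutator_le_of_rotate {A B C N : Subgroup G} [hN : N.Normal]
    (h1 : ⁅⁅B, C⁆, A⁆ ≤ N) (h2 : ⁅⁅C, A⁆, B⁆ ≤ N) : ⁅⁅A, B⁆, C⁆ ≤ N := by
  have key : ∀ H : Subgroup G, H ≤ N ↔ H.map (QuotientGroup.mk' N) = ⊥ := fun H => by
    rw [Subgroup.map_eq_bot_iff, QuotientGroup.ker_mk']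
  rw [key, Subgroup.map_commutator, Subgroup.map_commutator] at *
  exact Subgroup.commutator_commutator_eq_bot_of_rotate h1 h2

end CommutatorCalculus

section LowerExponentSeries

variable {p : ℕ} {G : Type*} [Group G]

local notation "𝓝" => lowerExponentSeries p G

instance lowerExponentSeries_normal (k : ℕ) : (𝓝 k).Normal := by
  induction k with
  | zero => rw [lowerExponentSeries]; infer_instance
  | succ k ih => rw [lowerExponentSeries]; infer_instance

theorem pow_mem_lowerExponentSeries {k : ℕ} {a : G} (ha : a ∈ 𝓝 k) : a ^ p ∈ 𝓝 (k + 1) := by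
  rw [lowerExponentSeries]
  exact Subgroup.mem_sup_left (Subgroup.subset_normalClosure ⟨a, ha, rfl⟩)

theorem commutator_mem_lowerExponentSeries {k : ℕ} {a : G} (ha : a ∈ 𝓝 k) (g : G) :
    ⁅a, g⁆ ∈ 𝓝 (k + 1) := by
  rw [lowerExponentSeries]
  exact Subgroup.mem_sup_right (Subgroup.commutator_mem_commutator ha (Subgroup.mem_top g))

theorem lowerExponentSeries_succ_le {k : ℕ} {K : Subgroup G} [K.Normal]
    (h1 : ∀ a ∈ 𝓝 k, a ^ p ∈ K) (h2 : ∀ a ∈ 𝓝 k, ∀ g, ⁅a, g⁆ ∈ K) : 𝓝 (k + 1) ≤ K := by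
  rw [lowerExponentSeries]
  refine sup_le (Subgroup.normalClosure_le_normal ?_) (Subgroup.commutator_le.2 fun a ha g _ => h2 a ha g)
  rintro _ ⟨a, ha, rfl⟩
  exact h1 a ha

theorem lowerExponentSeries_succ_le_self (k : ℕ) : 𝓝 (k + 1) ≤ 𝓝 k :=
  lowerExponentSeries_succ_le (fun _ ha => pow_mem ha p) fun a ha g => by
    rw [commutatorElement_def, mul_assoc, mul_assoc]
    refine mul_mem ha ?_
    rw [← mul_assoc]
    exact (lowerExponentSeries_normal k).conj_mem _ (inv_mem ha) g

theorem lowerExponentSeries_antitone : Antitone (𝓝) :=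
  antitone_nat_of_succ_le lowerExponentSeries_succ_le_self

theorem pow_pow_mem_lowerExponentSeries (x : G) (k : ℕ) : x ^ p ^ k ∈ 𝓝 k := by
  induction k with
  | zero => rw [lowerExponentSeries]; exact Subgroup.mem_top _
  | succ k ih => rw [pow_succ, pow_mul]; exact pow_mem_lowerExponentSeries ih

/-- Elements of a term of the series are central modulo the next term. -/
theorem commute_mk_of_mem_lowerExponentSeries {k : ℕ} {a : G} (ha : a ∈ 𝓝 k) (g : G) :
    Commute (a : G ⧸ 𝓝 (k + 1)) (g : G ⧸ 𝓝 (k + 1)) := by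
  rw [← commutatorElement_eq_one_iff_commute]
  exact (QuotientGroup.eq_one_iff _).2 (commutator_mem_lowerExponentSeries ha g)

theorem mk_mul_pow_of_commutator_mem (hp : p.Prime) (hodd : Odd p) {k : ℕ} {a b : G}
    (hab : ⁅b, a⁆ ∈ 𝓝 k) :
    (((a * b) ^ p : G) : G ⧸ 𝓝 (k + 1)) = ((a ^ p * b ^ p : G) : G ⧸ 𝓝 (k + 1)) := by
  have h := mul_pow_prime_of_commute_commutator hp hodd (a := (a : G ⧸ 𝓝 (k + 1)))
    (b := (b : G ⧸ 𝓝 (k + 1))) (commute_mk_of_mem_lowerExponentSeries hab a)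
    (commute_mk_of_mem_lowerExponentSeries hab b)
    ((QuotientGroup.eq_one_iff _).2 (pow_mem_lowerExponentSeries hab))
  exact h

theorem commutator_lowerExponentSeries_le (a b : ℕ) :
    ⁅𝓝 a, 𝓝 b⁆ ≤ 𝓝 (a + b + 1) := by
  induction b generalizing a with
  | zero => exact Subgroup.commutator_le.2 fun u hu v _ => commutator_mem_lowerExponentSeries hu v
  | succ b ih =>
    have h3 : ⁅⁅𝓝 b, (⊤ : Subgroup G)⁆, 𝓝 a⁆ ≤ 𝓝 (a + b + 2) := by
      refine commutator_commutator_le_of_rotate ?_ ?_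
      · have h : ⁅(⊤ : Subgroup G), 𝓝 a⁆ ≤ 𝓝 (a + 1) := by
          rw [Subgroup.commutator_comm]
          exact Subgroup.commutator_le.2 fun u hu v _ => commutator_mem_lowerExponentSeries hu v
        refine (Subgroup.commutator_mono h le_rfl).trans ((ih (a + 1)).trans_eq ?_)
        congr 1; omega
      · exact Subgroup.commutator_le.2 fun u hu v _ =>
          commutator_mem_lowerExponentSeries (ih a hu) v
    let C : Subgroup G := (Subgroup.centralizer
      (((𝓝 a).map (QuotientGroup.mk' (𝓝 (a + b + 2))) : Subgroup _) : Set _)).comap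
        (QuotientGroup.mk' (𝓝 (a + b + 2)))
    have hnorm : ((𝓝 a).map (QuotientGroup.mk' (𝓝 (a + b + 2)))).Normal :=
      Subgroup.Normal.map inferInstance _ (QuotientGroup.mk'_surjective _)
    have hCn : C.Normal := inferInstance
    have hC : ∀ w, w ∈ C ↔ ∀ u ∈ 𝓝 a, ⁅u, w⁆ ∈ 𝓝 (a + b + 2) := by
      intro w
      simp only [C, Subgroup.mem_comap, Subgroup.mem_centralizer_iff, Subgroup.coe_map,
        Set.forall_mem_image, SetLike.mem_coe]
      refine forall₂_congr fun u _ => ?_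
      rw [← commutatorElement_eq_one_iff_mul_comm, ← map_commutatorElement]
      exact QuotientGroup.eq_one_iff _
    have hle : 𝓝 (b + 1) ≤ C := by
      refine lowerExponentSeries_succ_le (fun v hv => (hC _).2 fun u hu => ?_)
        (fun v hv g => (hC _).2 fun u hu => ?_)
      · have huv : ⁅u, v⁆ ∈ 𝓝 (a + b + 1) := ih a (Subgroup.commutator_mem_commutator hu hv)
        have hcv := commute_mk_of_mem_lowerExponentSeries huv v
        have hcp : ((⁅u, v⁆ : G) : G ⧸ 𝓝 (a + b + 2)) ^ p = 1 :=
          (QuotientGroup.eq_one_iff _).2 (pow_mem_lowerExponentSeries huv)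
        have e : ⁅u, v ^ p⁆ = (⁅u, v⁆ * v) ^ p * (v ^ p)⁻¹ := by
          have : ⁅u, v⁆ * v = u * v * u⁻¹ := by rw [commutatorElement_def]; group
          rw [this, conj_pow, commutatorElement_def]
        have h : ((⁅u, v⁆ * v : G) : G ⧸ 𝓝 (a + b + 2)) ^ p = (v : G ⧸ 𝓝 (a + b + 2)) ^ p := by
          rw [QuotientGroup.mk_mul, hcv.mul_pow, hcp, one_mul]
        rw [← QuotientGroup.eq_one_iff, e, QuotientGroup.mk_mul, QuotientGroup.mk_pow, h,
          QuotientGroup.mk_inv, QuotientGroup.mk_pow, mul_inv_cancel]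
      · rw [← commutatorElement_inv]
        exact inv_mem (h3 (Subgroup.commutator_mem_commutator
          (Subgroup.commutator_mem_commutator hv (Subgroup.mem_top g)) hu))
    exact Subgroup.commutator_le.2 fun u hu w hw => (hC w).1 (hle hw) u hu

theorem map_lowerExponentSeries_le {G' : Type*} [Group G'] (f : G →* G') (k : ℕ) :
    𝓝 k ≤ (lowerExponentSeries p G' k).comap f := by
  induction k with
  | zero => simp [lowerExponentSeries]
  | succ k ih =>
    refine lowerExponentSeries_succ_le (fun a ha => ?_) fun a ha g => ?_
    · rw [Subgroup.mem_comap, map_pow]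
      exact pow_mem_lowerExponentSeries (ih ha)
    · rw [Subgroup.mem_comap, map_commutatorElement]
      exact commutator_mem_lowerExponentSeries (ih ha) _

end LowerExponentSeries

theorem exists_lowerExponentSeries_eq_bot {p : ℕ} (hp : p.Prime) (n : ℕ) :
    ∀ (G : Type*) [Group G] [Finite G], Nat.card G = n → IsPGroup p G →
      ∃ m, lowerExponentSeries p G m = ⊥ := by
  induction n using Nat.strong_induction_on with
  | _ n ih =>
  intro G _ _ hn hG
  have : Fact p.Prime := ⟨hp⟩
  rcases subsingleton_or_nontrivial G with h | h
  · exact ⟨0, Subsingleton.elim _ _⟩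
  have hZ := hG.center_nontrivial
  have hdvd : p ∣ Nat.card (Subgroup.center G) := by
    rcases (hG.to_subgroup (Subgroup.center G)).card_eq_or_dvd with h1 | h1
    · exact absurd h1 Finite.one_lt_card.ne'
    · exact h1
  obtain ⟨z, hz⟩ := exists_prime_orderOf_dvd_card' p hdvd
  have hz' : orderOf (z : G) = p := by rw [Subgroup.orderOf_coe, hz]
  have hle : Subgroup.zpowers (z : G) ≤ Subgroup.center G :=
    Subgroup.zpowers_le.2 z.2
  have hnorm : (Subgroup.zpowers (z : G)).Normal :=
    ⟨fun a ha g => by rwa [Subgroup.mem_center_iff.1 (hle ha) g, mul_inv_cancel_right]⟩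
  have hcard := (Subgroup.zpowers (z : G)).card_eq_card_quotient_mul_card_subgroup
  rw [Nat.card_zpowers, hz'] at hcard
  have hlt : Nat.card (G ⧸ Subgroup.zpowers (z : G)) < n := by
    have : 0 < Nat.card (G ⧸ Subgroup.zpowers (z : G)) := Nat.card_pos
    have := hp.two_le
    rw [← hn, hcard]
    nlinarith
  obtain ⟨m, hm⟩ := ih _ hlt (G ⧸ Subgroup.zpowers (z : G)) rfl (hG.to_quotient _)
  have hmem : ∀ a ∈ lowerExponentSeries p G m, a ∈ Subgroup.zpowers (z : G) := fun a ha => by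
    have := map_lowerExponentSeries_le (QuotientGroup.mk' (Subgroup.zpowers (z : G))) m ha
    rw [Subgroup.mem_comap, hm, Subgroup.mem_bot] at this
    exact (QuotientGroup.eq_one_iff _).1 this
  refine ⟨m + 1, le_bot_iff.1 (lowerExponentSeries_succ_le (fun a ha => ?_) fun a ha g => ?_)⟩
  · obtain ⟨t, rfl⟩ := Subgroup.mem_zpowers_iff.1 (hmem a ha)
    rw [Subgroup.mem_bot, ← zpow_natCast, zpow_comm, zpow_natCast, ← hz', pow_orderOf_eq_one,
      one_zpow]
  · rw [Subgroup.mem_bot, commutatorElement_eq_one_iff_commute]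
    exact (Subgroup.mem_center_iff.1 (hle (hmem a ha)) g).symm

section PowerfulModCenter

/-- `[G, G] ≤ G^p Z(G)`, a reformulation of quasi-powerfulness inside `G`. -/
def IsPowerfulModCenter (p : ℕ) (G : Type*) [Group G] : Prop :=
  commutator G ≤ powSubgroup G p ⊔ Subgroup.center G

theorem IsQuasiPowerful.isPowerfulModCenter {p : ℕ} {G : Type*} [Group G]
    (h : IsQuasiPowerful p G) : IsPowerfulModCenter p G := by
  have hcomap : ∀ x : G ⧸ Subgroup.center G, x ∈ powSubgroup (G ⧸ Subgroup.center G) p →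
      x ∈ (powSubgroup G p).map (QuotientGroup.mk' (Subgroup.center G)) := by
    intro x hx
    refine (Subgroup.closure_le _).2 ?_ hx
    rintro _ ⟨g, rfl⟩
    obtain ⟨g, rfl⟩ := QuotientGroup.mk'_surjective _ g
    exact ⟨g ^ p, Subgroup.subset_closure ⟨g, rfl⟩, map_pow _ _ _⟩
  rw [IsPowerfulModCenter, commutator_def, Subgroup.commutator_le]
  intro a _ b _
  have hab : ((⁅a, b⁆ : G) : G ⧸ Subgroup.center G) ∈ commutator (G ⧸ Subgroup.center G) :=
    Subgroup.commutator_mem_commutator (Subgroup.mem_top (a : G ⧸ Subgroup.center G))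
      (Subgroup.mem_top (b : G ⧸ Subgroup.center G))
  obtain ⟨u, hu, huv⟩ := hcomap _ (h hab)
  exact Subgroup.mem_sup_of_normal_right.2 ⟨u, hu, u⁻¹ * ⁅a, b⁆, QuotientGroup.eq.1 huv,
    mul_inv_cancel_left _ _⟩

theorem IsPowerfulModCenter.of_surjective {p : ℕ} {G G' : Type*} [Group G] [Group G']
    (h : IsPowerfulModCenter p G) (f : G →* G') (hf : Function.Surjective f) :
    IsPowerfulModCenter p G' := by
  have hle : powSubgroup G p ⊔ Subgroup.center G ≤
      (powSubgroup G' p ⊔ Subgroup.center G').comap f := by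
    refine sup_le ((Subgroup.closure_le _).2 ?_) fun z hz => ?_
    · rintro _ ⟨g, rfl⟩
      exact Subgroup.mem_sup_left (Subgroup.subset_closure ⟨f g, (map_pow f g p).symm⟩)
    · refine Subgroup.mem_sup_right (Subgroup.mem_center_iff.2 fun g' => ?_)
      obtain ⟨g, rfl⟩ := hf g'
      rw [← map_mul, ← map_mul, Subgroup.mem_center_iff.1 hz]
  rw [IsPowerfulModCenter, commutator_def, Subgroup.commutator_le]
  intro a _ b _
  obtain ⟨a, rfl⟩ := hf a
  obtain ⟨b, rfl⟩ := hf b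
  rw [← map_commutatorElement]
  exact hle (h (Subgroup.commutator_mem_commutator (Subgroup.mem_top a) (Subgroup.mem_top b)))

variable {p : ℕ} {G : Type*} [Group G]

local notation "𝓝" => lowerExponentSeries p G

/-- The elements congruent to `a ^ p * z` modulo `N_{k+2}`, with `a ∈ N_k` and `z` central. -/
def powModSubgroup (hp : p.Prime) (hodd : Odd p) (k : ℕ) : Subgroup G where
  carrier := {u | ∃ a ∈ 𝓝 k, ∃ z ∈ Subgroup.center G,
    (u : G ⧸ 𝓝 (k + 2)) = ((a ^ p * z : G) : G ⧸ 𝓝 (k + 2))}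
  one_mem' := ⟨1, one_mem _, 1, one_mem _, by simp⟩
  mul_mem' := by
    rintro u v ⟨a, ha, z, hz, hu⟩ ⟨b, hb, y, hy, hv⟩
    refine ⟨a * b, mul_mem ha hb, z * y, mul_mem hz hy, ?_⟩
    have h := mk_mul_pow_of_commutator_mem hp hodd (commutator_mem_lowerExponentSeries hb a)
    rw [QuotientGroup.mk_mul, hu, hv, QuotientGroup.mk_mul _ ((a * b) ^ p), h,
      ← QuotientGroup.mk_mul, ← QuotientGroup.mk_mul]
    congr 1
    rw [mul_assoc, ← mul_assoc z, ← Subgroup.mem_center_iff.1 hz]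
    simp only [mul_assoc]
  inv_mem' := by
    rintro u ⟨a, ha, z, hz, hu⟩
    refine ⟨a⁻¹, inv_mem ha, z⁻¹, inv_mem hz, ?_⟩
    rw [QuotientGroup.mk_inv, hu, ← QuotientGroup.mk_inv, mul_inv_rev, inv_pow,
      Subgroup.mem_center_iff.1 (inv_mem hz)]

instance powModSubgroup_normal (hp : p.Prime) (hodd : Odd p) (k : ℕ) :
    (powModSubgroup (G := G) hp hodd k).Normal where
  conj_mem := by
    rintro u ⟨a, ha, z, hz, hu⟩ g
    refine ⟨g * a * g⁻¹, (lowerExponentSeries_normal k).conj_mem a ha g, z, hz, ?_⟩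
    rw [QuotientGroup.mk_mul, QuotientGroup.mk_mul, hu, ← QuotientGroup.mk_mul,
      ← QuotientGroup.mk_mul, conj_pow]
    congr 1
    rw [mul_assoc, mul_assoc (a ^ p), ← Subgroup.mem_center_iff.1 hz]
    simp only [mul_assoc]

theorem lowerExponentSeries_succ_le_powModSubgroup (hp : p.Prime) (hodd : Odd p)
    (hG : IsPowerfulModCenter p G) (k : ℕ) : 𝓝 (k + 1) ≤ powModSubgroup hp hodd k := by
  have hpow : ∀ k, ∀ a ∈ 𝓝 k, a ^ p ∈ powModSubgroup hp hodd k := fun k a ha =>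
    ⟨a, ha, 1, one_mem _, by rw [mul_one]⟩
  induction k with
  | zero =>
    refine lowerExponentSeries_succ_le (hpow 0) fun a _ g => ?_
    refine (sup_le ((Subgroup.closure_le _).2 ?_) fun z hz => ?_ :
      powSubgroup G p ⊔ Subgroup.center G ≤ powModSubgroup hp hodd 0)
      (hG (Subgroup.commutator_mem_commutator (Subgroup.mem_top a) (Subgroup.mem_top g)))
    · rintro _ ⟨x, rfl⟩
      exact hpow 0 x (by rw [lowerExponentSeries]; exact Subgroup.mem_top x)
    · exact ⟨1, one_mem _, z, hz, by rw [one_pow, one_mul]⟩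
  | succ k ih =>
    refine lowerExponentSeries_succ_le (hpow _) fun a ha g => ?_
    obtain ⟨b, hb, z, hz, hab⟩ := ih ha
    obtain ⟨r, hr, rfl⟩ : ∃ r ∈ 𝓝 (k + 2), a = b ^ p * z * r :=
      ⟨(b ^ p * z)⁻¹ * a, QuotientGroup.eq.1 hab.symm, (mul_inv_cancel_left _ _).symm⟩
    have hc : ⁅b, g⁆ ∈ 𝓝 (k + 1) := commutator_mem_lowerExponentSeries hb g
    refine ⟨⁅b, g⁆, hc, 1, one_mem _, ?_⟩
    have hrg := commute_mk_of_mem_lowerExponentSeries hr g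
    have hL := mk_mul_pow_of_commutator_mem hp hodd
      (commutator_mem_lowerExponentSeries hc b⁻¹)
    have e1 : ⁅b ^ p, g⁆ = b ^ p * (b⁻¹ * ⁅b, g⁆) ^ p := by
      have : b⁻¹ * ⁅b, g⁆ = g * b⁻¹ * g⁻¹ := by rw [commutatorElement_def]; group
      rw [this, conj_pow, commutatorElement_def, inv_pow]
      simp only [mul_assoc]
    have e2 : ⁅b ^ p * z * r, g⁆ = b ^ p * ⁅r, g⁆ * (b ^ p)⁻¹ * ⁅b ^ p, g⁆ := by
      rw [mul_assoc, Subgroup.mem_center_iff.1 hz r |>.symm, ← mul_assoc,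
        commutatorElement_mul_left_eq_conj_mul _ z, (show Commute z g from
          (Subgroup.mem_center_iff.1 hz g).symm).commutator_eq, mul_one, mul_inv_cancel, one_mul,
        commutatorElement_mul_left_eq_conj_mul]
    have e3 : ((⁅r, g⁆ : G) : G ⧸ 𝓝 (k + 1 + 2)) = 1 :=
      (QuotientGroup.eq_one_iff _).2 (commutator_mem_lowerExponentSeries hr g)
    rw [e2, e1, mul_one]
    rw [QuotientGroup.mk_mul, QuotientGroup.mk_mul, QuotientGroup.mk_mul, e3, mul_one,
      ← QuotientGroup.mk_mul, mul_inv_cancel, QuotientGroup.mk_one, one_mul,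
      QuotientGroup.mk_mul, hL, ← QuotientGroup.mk_mul, inv_pow, mul_inv_cancel_left]

theorem exists_pow_mul_mul_eq (hp : p.Prime) (hodd : Odd p) (hG : IsPowerfulModCenter p G)
    {k : ℕ} {u : G} (hu : u ∈ 𝓝 (k + 1)) (m : ℕ) :
    ∃ a ∈ 𝓝 k, ∃ z ∈ Subgroup.center G, ∃ r ∈ 𝓝 (k + 1 + m), u = a ^ p * z * r := by
  induction m with
  | zero => exact ⟨1, one_mem _, 1, one_mem _, u, hu, by simp⟩
  | succ m ih =>
    obtain ⟨a, ha, z, hz, r, hr, rfl⟩ := ih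
    have hr' : r ∈ 𝓝 (k + m + 1) := by rwa [show k + m + 1 = k + 1 + m by omega]
    obtain ⟨s, hs, y, hy, hrs⟩ := lowerExponentSeries_succ_le_powModSubgroup hp hodd hG _ hr'
    have h := mk_mul_pow_of_commutator_mem hp hodd (commutator_mem_lowerExponentSeries hs a)
    refine ⟨a * s, mul_mem ha (lowerExponentSeries_antitone (by omega) hs), z * y, mul_mem hz hy,
      ((a * s) ^ p * (z * y))⁻¹ * (a ^ p * z * r), ?_, (mul_inv_cancel_left _ _).symm⟩
    rw [show k + 1 + (m + 1) = k + m + 2 by omega, ← QuotientGroup.eq, QuotientGroup.mk_mul, h,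
      QuotientGroup.mk_mul _ (a ^ p * z), hrs, ← QuotientGroup.mk_mul, ← QuotientGroup.mk_mul]
    congr 1
    rw [mul_assoc (a ^ p) z, ← mul_assoc z, ← Subgroup.mem_center_iff.1 hz (s ^ p)]
    simp only [mul_assoc]

theorem exists_pow_mul_eq [Finite G] (hp : p.Prime) (hodd : Odd p) (hpG : IsPGroup p G)
    (hG : IsPowerfulModCenter p G) {k : ℕ} {u : G} (hu : u ∈ 𝓝 (k + 1)) :
    ∃ a ∈ 𝓝 k, ∃ z ∈ Subgroup.center G, u = a ^ p * z := by
  obtain ⟨m, hm⟩ := exists_lowerExponentSeries_eq_bot hp _ G rfl hpG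
  obtain ⟨a, ha, z, hz, r, hr, rfl⟩ := exists_pow_mul_mul_eq hp hodd hG hu m
  have : r ∈ 𝓝 m := lowerExponentSeries_antitone (by omega) hr
  rw [hm, Subgroup.mem_bot] at this
  exact ⟨a, ha, z, hz, by rw [this, mul_one]⟩

theorem exists_pow_pow_mul_eq [Finite G] (hp : p.Prime) (hodd : Odd p) (hpG : IsPGroup p G)
    (hG : IsPowerfulModCenter p G) {k : ℕ} {u : G} (hu : u ∈ 𝓝 k) :
    ∃ g, ∃ z ∈ Subgroup.center G, u = g ^ p ^ k * z := by
  induction k generalizing u with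
  | zero => exact ⟨u, 1, one_mem _, by simp⟩
  | succ k ih =>
    obtain ⟨a, ha, z, hz, rfl⟩ := exists_pow_mul_eq hp hodd hpG hG hu
    obtain ⟨g, y, hy, rfl⟩ := ih ha
    refine ⟨g, y ^ p * z, mul_mem (pow_mem hy p) hz, ?_⟩
    rw [(show Commute (g ^ p ^ k) y from Subgroup.mem_center_iff.1 hy _).mul_pow, ← pow_mul,
      ← pow_succ, mul_assoc]

/-- If `x`, the centre and `N_1` generate `G`, then `x` and the centre generate `G`. -/
theorem commute_of_zpowers_sup_eq_top [Finite G] (hp : p.Prime) (hpG : IsPGroup p G) {x : G}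
    (h : Subgroup.zpowers x ⊔ (𝓝 1 ⊔ Subgroup.center G) = ⊤) (a b : G) : Commute a b := by
  set K := Subgroup.zpowers x ⊔ Subgroup.center G with hK
  have hKc : ∀ u ∈ K, ∀ v ∈ K, Commute u v := by
    intro u hu v hv
    obtain ⟨_, ⟨m, rfl⟩, z, hz, rfl⟩ := Subgroup.mem_sup_of_normal_right.1 hu
    obtain ⟨_, ⟨n, rfl⟩, y, hy, rfl⟩ := Subgroup.mem_sup_of_normal_right.1 hv
    have hz' : ∀ g, Commute g z := Subgroup.mem_center_iff.1 hz
    have hy' : ∀ g, Commute g y := Subgroup.mem_center_iff.1 hy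
    exact (((Commute.refl x).zpow_zpow m n).mul_right (hy' _)).mul_left (hz' _).symm
  have key : ∀ k, K ⊔ 𝓝 (k + 1) = ⊤ := by
    intro k
    induction k with
    | zero => rw [hK, sup_assoc, sup_comm (Subgroup.center G), h]
    | succ k ih =>
      have hdec : ∀ g : G, ∃ u ∈ K, ∃ n ∈ 𝓝 (k + 1), u * n = g := fun g =>
        Subgroup.mem_sup_of_normal_right.1 (ih ▸ Subgroup.mem_top g)
      have hcomm : ∀ g g' : G, ⁅g, g'⁆ ∈ 𝓝 (k + 2) := by
        intro g g'
        obtain ⟨u, hu, n, hn, rfl⟩ := hdec g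
        obtain ⟨u', hu', n', hn', rfl⟩ := hdec g'
        rw [← QuotientGroup.eq_one_iff]
        refine commutatorElement_eq_one_iff_commute.2
          (Commute.mul_left (a := (u : G ⧸ 𝓝 (k + 2))) (b := n) ?_
            (commute_mk_of_mem_lowerExponentSeries hn _))
        exact Commute.mul_right (b := (u' : G ⧸ 𝓝 (k + 2))) (c := n')
          ((hKc u hu u' hu').map (QuotientGroup.mk' (𝓝 (k + 2))))
          (commute_mk_of_mem_lowerExponentSeries hn' u).symm
      have hnorm : (K ⊔ 𝓝 (k + 2)).Normal := ⟨fun a ha g => by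
        have : g * a * g⁻¹ = ⁅g, a⁆ * a := by rw [commutatorElement_def]; group
        rw [this]
        exact mul_mem (Subgroup.mem_sup_right (hcomm g a)) ha⟩
      have h1 : 𝓝 1 ≤ K ⊔ 𝓝 (k + 2) := by
        refine lowerExponentSeries_succ_le (fun g _ => ?_) fun a _ g =>
          Subgroup.mem_sup_right (hcomm a g)
        obtain ⟨u, hu, n, hn, rfl⟩ := hdec g
        refine Subgroup.mem_sup_of_normal_right.2 ⟨u ^ p, pow_mem hu p, (u ^ p)⁻¹ * (u * n) ^ p,
          ?_, mul_inv_cancel_left _ _⟩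
        rw [← QuotientGroup.eq, QuotientGroup.mk_pow _ (u * n), QuotientGroup.mk_mul,
          (commute_mk_of_mem_lowerExponentSeries hn u).symm.mul_pow, ← QuotientGroup.mk_pow _ n,
          (QuotientGroup.eq_one_iff (n ^ p)).2 (pow_mem_lowerExponentSeries hn), mul_one,
          QuotientGroup.mk_pow]
      have h2 : 𝓝 (k + 1) ≤ K ⊔ 𝓝 (k + 2) :=
        (lowerExponentSeries_antitone (Nat.le_add_left 1 k)).trans h1
      exact top_le_iff.1 (ih.symm.le.trans (sup_le le_sup_left h2))
  obtain ⟨m, hm⟩ := exists_lowerExponentSeries_eq_bot hp _ G rfl hpG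
  have hbot : 𝓝 (m + 1) = ⊥ := le_bot_iff.1 (hm ▸ lowerExponentSeries_succ_le_self m)
  have hKtop : K = ⊤ := by rw [← key m, hbot, sup_bot_eq]
  exact hKc a (hKtop ▸ Subgroup.mem_top a) b (hKtop ▸ Subgroup.mem_top b)

theorem isPowerfulModCenter_zpowers_sup [Finite G] (hp : p.Prime) (hodd : Odd p)
    (hpG : IsPGroup p G) (hG : IsPowerfulModCenter p G) (x : G) :
    IsPowerfulModCenter p ↥(Subgroup.zpowers x ⊔ (𝓝 1 ⊔ Subgroup.center G)) := by
  set H := Subgroup.zpowers x ⊔ (𝓝 1 ⊔ Subgroup.center G) with hH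
  have hNH : 𝓝 1 ≤ H := le_sup_left.trans le_sup_right
  have hZH : Subgroup.center G ≤ H := le_sup_right.trans le_sup_right
  have hcent : ∀ t ∈ 𝓝 1 ⊔ Subgroup.center G, ∀ g : G,
      Commute (t : G ⧸ 𝓝 2) (g : G ⧸ 𝓝 2) := by
    intro t ht g
    obtain ⟨n, hn, z, hz, rfl⟩ := Subgroup.mem_sup_of_normal_right.1 ht
    have hz' : Commute z g := (Subgroup.mem_center_iff.1 hz g).symm
    exact Commute.mul_left (a := (n : G ⧸ 𝓝 2)) (b := z)
      (commute_mk_of_mem_lowerExponentSeries hn g) (hz'.map (QuotientGroup.mk' (𝓝 2)))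
  have hcomm : ∀ u ∈ H, ∀ v ∈ H, ⁅u, v⁆ ∈ 𝓝 2 := by
    intro u hu v hv
    obtain ⟨_, ⟨m, rfl⟩, s, hs, rfl⟩ := Subgroup.mem_sup_of_normal_right.1 hu
    obtain ⟨_, ⟨n, rfl⟩, t, ht, rfl⟩ := Subgroup.mem_sup_of_normal_right.1 hv
    rw [← QuotientGroup.eq_one_iff]
    refine commutatorElement_eq_one_iff_commute.2
      (Commute.mul_left (a := ((x ^ m : G) : G ⧸ 𝓝 2)) (b := s) ?_ (hcent s hs _))
    exact Commute.mul_right (b := ((x ^ n : G) : G ⧸ 𝓝 2)) (c := t)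
      (((Commute.refl x).zpow_zpow m n).map (QuotientGroup.mk' (𝓝 2))) (hcent t ht _).symm
  rw [IsPowerfulModCenter, commutator_def, Subgroup.commutator_le]
  rintro ⟨u, hu⟩ _ ⟨v, hv⟩ _
  obtain ⟨a, ha, z, hz, huv⟩ := exists_pow_mul_eq hp hodd hpG hG (hcomm u hu v hv)
  have e : ⁅(⟨u, hu⟩ : H), (⟨v, hv⟩ : H)⁆ = (⟨a, hNH ha⟩ : H) ^ p * ⟨z, hZH hz⟩ := Subtype.ext huv
  rw [e]
  refine Subgroup.mul_mem_sup (Subgroup.subset_closure ⟨_, rfl⟩) (Subgroup.mem_center_iff.2 ?_)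
  exact fun g => Subtype.ext (Subgroup.mem_center_iff.1 hz g)

end PowerfulModCenter

section PowerLaws

/-- Elements of order at most `p ^ i` modulo the centre satisfy `(ab)^(p^i) = a^(p^i) b^(p^i)`. -/
def CentralMulPowLaw (p : ℕ) (G : Type*) [Group G] : Prop :=
  ∀ (i : ℕ) (a b : G), a ^ p ^ i ∈ Subgroup.center G → b ^ p ^ i ∈ Subgroup.center G →
    (a * b) ^ p ^ i = a ^ p ^ i * b ^ p ^ i

/-- The bound on the order of `[x^(p^j), y^(p^k)]`, with orders of `x` and `y` taken modulo the
centre. -/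
def CentralCommutatorPowLaw (p : ℕ) (G : Type*) [Group G] : Prop :=
  ∀ (i : ℕ) (x y : G), x ^ p ^ (i + 1) ∈ Subgroup.center G → y ^ p ^ i ∈ Subgroup.center G →
    ∀ j k, j + k ≤ i → ⁅x ^ p ^ j, y ^ p ^ k⁆ ^ p ^ (i - j - k) = 1

variable {p : ℕ} {G : Type*} [Group G]

local notation "𝓝" => lowerExponentSeries p G

theorem commutator_pow_eq_one_of_pow_mem_center {y : G}
    (hH : CentralMulPowLaw p ↥(Subgroup.zpowers y ⊔ (𝓝 1 ⊔ Subgroup.center G)))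
    (hy : y ^ p ∈ Subgroup.center G) (g : G) : ⁅y, g⁆ ^ p = 1 := by
  set H := Subgroup.zpowers y ⊔ (𝓝 1 ⊔ Subgroup.center G)
  have hyH : y ∈ H := Subgroup.mem_sup_left (Subgroup.mem_zpowers y)
  have hcH : ⁅y, g⁆ ∈ H := Subgroup.mem_sup_right (Subgroup.mem_sup_left
    (commutator_mem_lowerExponentSeries
      (by rw [lowerExponentSeries]; exact Subgroup.mem_top y) g))
  have e : g * y⁻¹ * g⁻¹ = y⁻¹ * ⁅y, g⁆ := by rw [commutatorElement_def]; group
  have hconj : (g * y⁻¹ * g⁻¹) ^ p = (y ^ p)⁻¹ := by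
    rw [conj_pow, inv_pow, Subgroup.mem_center_iff.1 (inv_mem hy), mul_inv_cancel_right]
  have hbH : g * y⁻¹ * g⁻¹ ∈ H := by rw [e]; exact mul_mem (inv_mem hyH) hcH
  have h := hH 1 ⟨y, hyH⟩ ⟨g * y⁻¹ * g⁻¹, hbH⟩
    (Subgroup.mem_center_iff.2 fun u => Subtype.ext (by
      simpa using Subgroup.mem_center_iff.1 hy u))
    (Subgroup.mem_center_iff.2 fun u => Subtype.ext (by
      simpa only [Subgroup.coe_mul, Subgroup.coe_pow, pow_one, hconj] using
        Subgroup.mem_center_iff.1 (inv_mem hy) u))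
  have h' := congrArg (Subtype.val) h
  simp only [Subgroup.coe_mul, Subgroup.coe_pow, pow_one] at h'
  rw [hconj, mul_inv_cancel, e, mul_inv_cancel_left] at h'
  exact h'

theorem commute_pow_pow_of_quotient [Finite G] (hp : p.Prime) (hodd : Odd p)
    (hpG : IsPGroup p G) (hG : IsPowerfulModCenter p G) {M : Subgroup G} [M.Normal]
    (hMp : ∀ g ∈ M, g ^ p = 1)
    (hMZ : ∀ y : G, y ^ p ∈ Subgroup.center G → (y : G ⧸ M) ∈ Subgroup.center (G ⧸ M))
    (hB : CentralCommutatorPowLaw p (G ⧸ M)) {e : ℕ} (he : ∀ g : G, g ^ p ^ e = 1) (t : ℕ) :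
    ∀ i, 2 * e ≤ i + t → ∀ x y : G, x ^ p ^ (i + 1) ∈ Subgroup.center G →
      y ^ p ^ i ∈ Subgroup.center G → ∀ j k, j + k = i → Commute (x ^ p ^ j) (y ^ p ^ k) := by
  induction t with
  | zero =>
    intro i hi x y _ _ j k hjk
    have hbig : ∀ (g : G) (l : ℕ), e ≤ l → g ^ p ^ l = 1 := fun g l hl => by
      rw [← Nat.add_sub_cancel' hl, pow_add, pow_mul, he, one_pow]
    rcases le_total e j with h | h
    · rw [hbig x j h]; exact Commute.one_left _
    · rw [hbig y k (by omega)]; exact Commute.one_right _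
  | succ t ih =>
    intro i hi x y hx hy j k hjk
    rcases j with _ | j
    · rw [← hjk, zero_add] at hy
      exact Subgroup.mem_center_iff.1 hy _
    set w := x ^ p ^ j with hw
    set v := y ^ p ^ k with hv
    have hcM : ⁅v, w⁆ ∈ M := by
      have h := hB (j + k) (x : G ⧸ M) (y : G ⧸ M)
        (hMZ (x ^ p ^ (j + k + 1)) (by
          rw [← pow_mul, ← pow_succ, show j + k + 1 + 1 = i + 1 by omega]; exact hx))
        (hMZ (y ^ p ^ (j + k)) (by
          rw [← pow_mul, ← pow_succ, show j + k + 1 = i by omega]; exact hy))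
        j k le_rfl
      rw [show j + k - j - k = 0 by omega, pow_zero, pow_one] at h
      rw [← commutatorElement_inv]
      exact inv_mem ((QuotientGroup.eq_one_iff ⁅w, v⁆).1 h)
    have hcN : ⁅v, w⁆ ∈ 𝓝 i := by
      rw [show i = k + j + 1 by omega]
      exact commutator_lowerExponentSeries_le k j (Subgroup.commutator_mem_commutator
        (pow_pow_mem_lowerExponentSeries y k) (pow_pow_mem_lowerExponentSeries x j))
    set c := ⁅v, w⁆ with hc
    have hdN : ⁅w, c⁆ ∈ 𝓝 (i + 1) := by
      rw [← commutatorElement_inv]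
      exact inv_mem (commutator_mem_lowerExponentSeries hcN w)
    have hdM : ⁅w, c⁆ ∈ M := Subgroup.commutator_le_right ⊤ M
      (Subgroup.commutator_mem_commutator (Subgroup.mem_top w) hcM)
    have hdp : ⁅w, c⁆ ^ p = 1 := hMp _ hdM
    obtain ⟨g, z, hz, hgz⟩ := exists_pow_pow_mul_eq hp hodd hpG hG hdN
    have hzc : ∀ u, Commute u z := Subgroup.mem_center_iff.1 hz
    have hg : g ^ p ^ (i + 1 + 1) ∈ Subgroup.center G := by
      rw [hgz, (hzc _).mul_pow, ← pow_mul, ← pow_succ] at hdp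
      rw [eq_inv_of_mul_eq_one_left hdp]
      exact inv_mem (pow_mem hz p)
    have hD : ∀ Y : G, Y ^ p ^ (i + 1) ∈ Subgroup.center G → Commute ⁅w, c⁆ Y := by
      intro Y hY
      have h := ih (i + 1) (by omega) g Y hg hY (i + 1) 0 rfl
      rw [pow_zero, pow_one] at h
      rw [hgz]
      exact h.mul_left (hzc Y).symm
    have hcp : c ^ p = 1 := hMp c hcM
    have hmul : (c * w) ^ p = c ^ p * w ^ p := by
      refine mul_pow_prime_of_commute_commutator hp hodd (hD c ?_) (hD w ?_) hdp
      · rw [pow_succ', pow_mul, hcp, one_pow]; exact one_mem _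
      · rw [hw, ← pow_mul, mul_comm, pow_mul]; exact pow_mem hx _
    have hcw : c * w = v * w * v⁻¹ := by rw [hc, commutatorElement_def]; group
    rw [hcw, conj_pow, hcp, one_mul, mul_inv_eq_iff_eq_mul] at hmul
    rw [pow_succ, pow_mul]
    exact hmul.symm

theorem central_pow_laws_of_isPowerfulModCenter {p : ℕ} (hp : p.Prime) (hodd : Odd p) (n : ℕ) :
    ∀ (G : Type*) [Group G] [Finite G], Nat.card G = n → IsPGroup p G →
      IsPowerfulModCenter p G → CentralMulPowLaw p G ∧ CentralCommutatorPowLaw p G := by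
  induction n using Nat.strong_induction_on with
  | _ n ih =>
  intro G _ _ hn hpG hG
  by_cases hab : ∀ a b : G, Commute a b
  · exact ⟨fun i a b _ _ => (hab a b).mul_pow _, fun i x y _ _ j k _ => by
      rw [(hab _ _).commutator_eq, one_pow]⟩
  have : Fact p.Prime := ⟨hp⟩
  have hH : ∀ x : G, CentralMulPowLaw p
      ↥(Subgroup.zpowers x ⊔ (lowerExponentSeries p G 1 ⊔ Subgroup.center G)) := by
    intro x
    refine (ih _ ?_ _ rfl (hpG.to_subgroup _)
      (isPowerfulModCenter_zpowers_sup hp hodd hpG hG x)).1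
    rw [← hn]
    exact lt_of_le_of_ne (Subgroup.card_le_card_group _) fun h =>
      hab (commute_of_zpowers_sup_eq_top hp hpG (Subgroup.eq_top_of_card_eq _ h))
  have hcN : ∀ y g : G, ⁅y, g⁆ ∈ lowerExponentSeries p G 1 := fun y g =>
    commutator_mem_lowerExponentSeries (by rw [lowerExponentSeries]; exact Subgroup.mem_top y) g
  have hcp : ∀ y g : G, y ^ p ∈ Subgroup.center G → ⁅y, g⁆ ^ p = 1 := fun y g hy =>
    commutator_pow_eq_one_of_pow_mem_center (hH y) hy g
  let M : Subgroup G :=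
    { carrier := {g | g ∈ lowerExponentSeries p G 1 ∧ g ^ p = 1}
      one_mem' := ⟨one_mem _, one_pow _⟩
      inv_mem' := fun {g} hg => ⟨inv_mem hg.1, by rw [inv_pow, hg.2, inv_one]⟩
      mul_mem' := fun {g h} hg hh => ⟨mul_mem hg.1 hh.1, by
        have hle : lowerExponentSeries p G 1 ≤
            Subgroup.zpowers (1 : G) ⊔ (lowerExponentSeries p G 1 ⊔ Subgroup.center G) :=
          le_sup_left.trans le_sup_right
        have hpow : ∀ {u : G} (hu : u ∈ lowerExponentSeries p G 1), u ^ p = 1 →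
            (⟨u, hle hu⟩ : ↥(Subgroup.zpowers (1 : G) ⊔
              (lowerExponentSeries p G 1 ⊔ Subgroup.center G))) ^ p ^ 1 = 1 := fun hu hup =>
          Subtype.ext (by rw [pow_one]; exact hup)
        have h1 := hH 1 1 ⟨g, hle hg.1⟩ ⟨h, hle hh.1⟩
          (by rw [hpow hg.1 hg.2]; exact one_mem _) (by rw [hpow hh.1 hh.2]; exact one_mem _)
        rw [hpow hg.1 hg.2, hpow hh.1 hh.2, mul_one, pow_one] at h1
        exact congrArg Subtype.val h1⟩ }
  have hMnorm : M.Normal := ⟨fun g hg h => ⟨(lowerExponentSeries_normal 1).conj_mem g hg.1 h, by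
    rw [conj_pow, hg.2, mul_one, mul_inv_cancel]⟩⟩
  have hMp : ∀ g ∈ M, g ^ p = 1 := fun g hg => hg.2
  have hMZ : ∀ y : G, y ^ p ∈ Subgroup.center G → (y : G ⧸ M) ∈ Subgroup.center (G ⧸ M) := by
    intro y hy
    refine Subgroup.mem_center_iff.2 fun g => ?_
    obtain ⟨g, rfl⟩ := QuotientGroup.mk_surjective g
    refine (commutatorElement_eq_one_iff_mul_comm.1 ?_).symm
    exact (QuotientGroup.eq_one_iff ⁅y, g⁆).2 ⟨hcN y g, hcp y g hy⟩
  obtain ⟨e, he⟩ : ∃ e, ∀ g : G, g ^ p ^ e = 1 := by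
    obtain ⟨e, he⟩ := hpG.exists_card_eq
    exact ⟨e, fun g => by rw [← he]; exact pow_card_eq_one'⟩
  have hMbot : M ≠ ⊥ := by
    intro hM
    have hroot : ∀ y : G, y ^ p ∈ Subgroup.center G → y ∈ Subgroup.center G := fun y hy =>
      Subgroup.mem_center_iff.2 fun g => by
        have : ⁅y, g⁆ ∈ M := ⟨hcN y g, hcp y g hy⟩
        rw [hM, Subgroup.mem_bot] at this
        exact (commutatorElement_eq_one_iff_mul_comm.1 this).symm
    have hall : ∀ k, ∀ y : G, y ^ p ^ k ∈ Subgroup.center G → y ∈ Subgroup.center G := by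
      intro k
      induction k with
      | zero => intro y hy; simpa using hy
      | succ k ihk => exact fun y hy => ihk y (hroot _ (by rwa [← pow_mul, ← pow_succ]))
    exact hab fun a b => Subgroup.mem_center_iff.1 (hall e b (by rw [he]; exact one_mem _)) a
  have hlt : Nat.card (G ⧸ M) < n := by
    have h1 : 1 < Nat.card M := by rwa [Subgroup.one_lt_card_iff_ne_bot]
    have h2 : 0 < Nat.card (G ⧸ M) := Nat.card_pos
    rw [← hn, M.card_eq_card_quotient_mul_card_subgroup]
    nlinarith
  obtain ⟨hA, hB⟩ := ih _ hlt (G ⧸ M) rfl (hpG.to_quotient M)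
    (hG.of_surjective (QuotientGroup.mk' M) (QuotientGroup.mk'_surjective M))
  have hD := fun i => commute_pow_pow_of_quotient hp hodd hpG hG hMp hMZ hB he (2 * e) i
    (Nat.le_add_left _ _)
  have hA1 : ∀ a b : G, a ^ p ∈ Subgroup.center G → b ^ p ∈ Subgroup.center G →
      (a * b) ^ p = a ^ p * b ^ p := by
    intro a b ha hb
    have hd : ⁅b, a⁆ ^ p = 1 := hcp b a hb
    obtain ⟨d, z, hz, hdz⟩ := exists_pow_pow_mul_eq hp hodd hpG hG (hcN b a)
    rw [pow_one] at hdz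
    have hzc : ∀ u, Commute u z := Subgroup.mem_center_iff.1 hz
    have hd2 : d ^ p ^ (1 + 1) ∈ Subgroup.center G := by
      rw [hdz, (hzc _).mul_pow, ← pow_mul, ← pow_two] at hd
      rw [eq_inv_of_mul_eq_one_left hd]
      exact inv_mem (pow_mem hz p)
    have hcomm : ∀ Y : G, Y ^ p ∈ Subgroup.center G → Commute ⁅b, a⁆ Y := by
      intro Y hY
      have h := hD 1 d Y hd2 (by rwa [pow_one]) 1 0 rfl
      rw [pow_zero, pow_one, pow_one] at h
      rw [hdz]
      exact h.mul_left (hzc Y).symm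
    exact mul_pow_prime_of_commute_commutator hp hodd (hcomm a ha) (hcomm b hb) hd
  refine ⟨?_, ?_⟩
  · intro i a b ha hb
    rcases i with _ | i
    · simp
    rw [pow_succ, pow_mul] at ha hb
    have h : (((a * b) ^ p ^ i : G) : G ⧸ M) = ((a ^ p ^ i * b ^ p ^ i : G) : G ⧸ M) :=
      hA i (a : G ⧸ M) (b : G ⧸ M) (hMZ _ ha) (hMZ _ hb)
    obtain ⟨m, hm, hmul⟩ : ∃ m ∈ M, (a * b) ^ p ^ i = a ^ p ^ i * b ^ p ^ i * m :=
      ⟨_, QuotientGroup.eq.1 h.symm, (mul_inv_cancel_left _ _).symm⟩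
    have hAB := hA1 _ _ ha hb
    rw [pow_succ, pow_mul, pow_mul, pow_mul, hmul,
      hA1 _ m (by rw [hAB]; exact mul_mem ha hb) (by rw [hMp m hm]; exact one_mem _), hMp m hm,
      mul_one, hAB]
  · intro i x y hx hy j k hjk
    rcases hjk.eq_or_lt with hjk | hjk
    · rw [(hD i x y hx hy j k hjk).commutator_eq, one_pow]
    obtain ⟨i, rfl⟩ : ∃ i', i = i' + 1 := ⟨i - 1, by omega⟩
    rw [pow_succ, pow_mul] at hx hy
    have h := hB i (x : G ⧸ M) (y : G ⧸ M) (hMZ _ hx) (hMZ _ hy) j k (by omega)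
    have hmem : ⁅x ^ p ^ j, y ^ p ^ k⁆ ^ p ^ (i - j - k) ∈ M := (QuotientGroup.eq_one_iff _).1 h
    rw [show i + 1 - j - k = i - j - k + 1 by omega, pow_succ, pow_mul]
    exact hMp _ hmem

end PowerLaws

theorem commutator_power_order_bound (p : ℕ) (hp : p.Prime) (hodd : Odd p)
    (G : Type*) [Group G] [Finite G]
    (hG : IsPGroup p G) (hQP : IsQuasiPowerful p G) (i : ℕ) (x y : G)
    (hx : x ^ p ^ (i + 1) = 1) (hy : y ^ p ^ i = 1) (j k : ℕ) :
    (j + k ≤ i → (pcomm (x ^ p ^ j) (y ^ p ^ k)) ^ p ^ (i - j - k) = 1) ∧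
    (i < j + k → pcomm (x ^ p ^ j) (y ^ p ^ k) = 1) := by
  have hcomm : pcomm (x ^ p ^ j) (y ^ p ^ k) = ⁅x⁻¹ ^ p ^ j, y⁻¹ ^ p ^ k⁆ := by
    rw [pcomm, commutatorElement_def, inv_pow, inv_pow, inv_inv, inv_inv]
  have hx' : x⁻¹ ^ p ^ (i + 1) ∈ Subgroup.center G := by
    rw [inv_pow, hx, inv_one]; exact one_mem _
  have hy' : ∀ l, i ≤ l → y⁻¹ ^ p ^ l = 1 := fun l hl => by
    rw [← Nat.add_sub_cancel' hl, pow_add, pow_mul, inv_pow, hy, inv_one, one_pow]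
  have hB := (central_pow_laws_of_isPowerfulModCenter hp hodd _ G rfl hG
    hQP.isPowerfulModCenter).2 i x⁻¹ y⁻¹ hx' (by rw [hy' i le_rfl]; exact one_mem _)
  refine ⟨fun h => hcomm ▸ hB j k h, fun h => ?_⟩
  rw [hcomm]
  rcases le_total i k with hk | hk
  · rw [hy' k hk, commutatorElement_one_right]
  · have h0 := hB (i - k) k (by omega)
    rw [show i - (i - k) - k = 0 by omega, pow_zero, pow_one,
      commutatorElement_eq_one_iff_commute] at h0
    rw [commutatorElement_eq_one_iff_commute, show j = i - k + (j - (i - k)) by omega, pow_add,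
      pow_mul]
    exact h0.pow_left _
end

section
/- Let p be an odd prime and let G be a quasi-powerful p-group with d(G) = d. Then G is a product of at most d + d(d+3)/2 cyclic subgroups; that is, there exist cyclic subgroups H_1, …, H_k of G with k ≤ d + d(d+3)/2 such that every element of G can be written as a product h_1 h_2 ⋯ h_k with h_i ∈ H_i. -/
open scoped Pointwise commutatorElement

section PowerSubgroup

variable {G : Type*} [Group G]

/-- The subgroup generated by the `p`-th powers of the elements of `N`. -/
def Subgroup.powers (p : ℕ) (N : Subgroup G) : Subgroup G :=
  Subgroup.closure ((fun x : G => x ^ p) '' (N : Set G))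

theorem Subgroup.pow_mem_powers {p : ℕ} {N : Subgroup G} {x : G} (hx : x ∈ N) :
    x ^ p ∈ N.powers p :=
  Subgroup.subset_closure ⟨x, hx, rfl⟩

theorem Subgroup.powers_le (p : ℕ) (N : Subgroup G) : N.powers p ≤ N := by
  rw [Subgroup.powers, Subgroup.closure_le]
  rintro _ ⟨x, hx, rfl⟩
  exact N.pow_mem hx p

instance Subgroup.powers_normal (p : ℕ) (N : Subgroup G) [hN : N.Normal] :
    (N.powers p).Normal := by
  refine ⟨fun x hx g => ?_⟩
  have h : N.powers p ≤ (N.powers p).comap (MulAut.conj g).toMonoidHom := by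
    conv_lhs => rw [Subgroup.powers]
    rw [Subgroup.closure_le]
    rintro _ ⟨y, hy, rfl⟩
    have := Subgroup.pow_mem_powers (p := p) (hN.conj_mem y hy g)
    simpa [conj_pow] using this
  simpa using h hx

/-- In a nontrivial finite `p`-group the `p`-th powers generate a proper subgroup. -/
theorem IsPGroup.powers_lt {p : ℕ} (hp : p.Prime) [Finite G] (hG : IsPGroup p G)
    {N : Subgroup G} (hN : N ≠ ⊥) : N.powers p < N := by
  have := Fact.mk hp
  have := N.nontrivial_iff_ne_bot.mpr hN
  obtain ⟨n, hn0, hn⟩ := (hG.to_subgroup N).nontrivial_iff_card.mp this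
  obtain ⟨m, rfl⟩ := Nat.exists_eq_succ_of_ne_zero hn0.ne'
  obtain ⟨H, hH⟩ := Sylow.exists_subgroup_card_pow_prime (G := N) p (n := m)
    (by rw [hn]; exact pow_dvd_pow p (Nat.le_succ m))
  have hidx : H.index = p := by
    have h := H.card_mul_index
    rw [hH, hn, Nat.succ_eq_add_one, pow_succ] at h
    exact Nat.eq_of_mul_eq_mul_left (pow_pos hp.pos m) h
  have hnorm : H.Normal := Subgroup.normal_of_index_eq_minFac_card (by
    rw [hidx, hn, Nat.Prime.pow_minFac hp (Nat.succ_ne_zero m)])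
  refine lt_of_le_of_ne (N.powers_le p) fun h => ?_
  have hle : N.powers p ≤ H.map N.subtype := by
    rw [Subgroup.powers, Subgroup.closure_le]
    rintro _ ⟨x, hx, rfl⟩
    refine ⟨⟨x, hx⟩ ^ p, ?_, rfl⟩
    have := H.pow_index_mem ⟨x, hx⟩
    rwa [hidx] at this
  rw [h] at hle
  have htop : H = ⊤ := by
    refine eq_top_iff.mpr fun x _ => ?_
    obtain ⟨y, hy, hyx⟩ := hle x.2
    rwa [← Subtype.ext hyx]
  rw [htop, Subgroup.index_top] at hidx
  exact hp.one_lt.ne hidx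

theorem IsPGroup.exists_iterate_powers_eq_bot {p : ℕ} (hp : p.Prime) [Finite G]
    (hG : IsPGroup p G) (N : Subgroup G) : ∃ j, (Subgroup.powers p)^[j] N = ⊥ := by
  have key : ∀ j, (Subgroup.powers p)^[j] N = ⊥ ∨
      Nat.card ((Subgroup.powers p)^[j] N) + j ≤ Nat.card N := by
    intro j
    induction j with
    | zero => exact Or.inr le_rfl
    | succ j ih =>
      rw [Function.iterate_succ_apply']
      by_cases hb : (Subgroup.powers p)^[j] N = ⊥
      · exact Or.inl (le_bot_iff.mp (hb ▸ Subgroup.powers_le p _))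
      · have h1 := ih.resolve_left hb
        have h2 : Nat.card (((Subgroup.powers p)^[j] N).powers p) <
            Nat.card ((Subgroup.powers p)^[j] N) :=
          Set.Finite.card_lt_card (Set.toFinite _) (hG.powers_lt hp hb)
        exact Or.inr (by omega)
  refine ⟨Nat.card N, (key _).resolve_right fun h => ?_⟩
  have : 0 < Nat.card ((Subgroup.powers p)^[Nat.card N] N) := Nat.card_pos
  omega

end PowerSubgroup

section CentralModulo

variable {G : Type*} [Group G]

theorem QuotientGroup.mk_commute_iff {K : Subgroup G} [K.Normal] {x y : G} :
    Commute (x : G ⧸ K) (y : G ⧸ K) ↔ ⁅x, y⁆ ∈ K := by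
  rw [← commutatorElement_eq_one_iff_commute, ← QuotientGroup.eq_one_iff]
  rfl

/-- The preimage in `G` of the centre of `G ⧸ K`. -/
def Subgroup.centralModulo (K : Subgroup G) [K.Normal] : Subgroup G :=
  (Subgroup.center (G ⧸ K)).comap (QuotientGroup.mk' K)

theorem Subgroup.mem_centralModulo {K : Subgroup G} [K.Normal] {x : G} :
    x ∈ K.centralModulo ↔ ∀ g, ⁅x, g⁆ ∈ K := by
  simp only [Subgroup.centralModulo, Subgroup.mem_comap, Subgroup.mem_center_iff,
    QuotientGroup.mk'_apply, ← QuotientGroup.mk_commute_iff]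
  exact ⟨fun h g => (h g).symm, fun h g => QuotientGroup.induction_on g fun g => (h g).symm⟩

theorem Subgroup.le_centralModulo_iff {K M : Subgroup G} [K.Normal] :
    M ≤ K.centralModulo ↔ ⁅M, (⊤ : Subgroup G)⁆ ≤ K := by
  rw [Subgroup.commutator_le]
  exact ⟨fun h x hx g _ => mem_centralModulo.mp (h hx) g,
    fun h x hx => mem_centralModulo.mpr fun g => h x hx g trivial⟩

theorem Subgroup.le_centralModulo_self {K : Subgroup G} [K.Normal] : K ≤ K.centralModulo :=
  le_centralModulo_iff.mpr (Subgroup.commutator_le_left K ⊤)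

theorem Subgroup.le_of_le_sup_commutator [Group.IsNilpotent G] {D R : Subgroup G} [R.Normal]
    (h : D ≤ R ⊔ ⁅D, (⊤ : Subgroup G)⁆) : D ≤ R := by
  obtain ⟨n, hn⟩ := Subgroup.nilpotent_iff_lowerCentralSeries.mp ‹Group.IsNilpotent G›
  have key : ∀ n, D ≤ R ⊔ (⊤ : Subgroup G).lowerCentralSeries n := by
    intro n
    induction n with
    | zero => simp
    | succ n ih =>
      refine h.trans (sup_le le_sup_left (le_centralModulo_iff.mp (ih.trans (sup_le ?_ ?_))))
      · exact le_centralModulo_iff.mpr ((Subgroup.commutator_le_left R ⊤).trans le_sup_left)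
      · exact le_centralModulo_iff.mpr le_sup_right
  simpa [hn] using key n

end CentralModulo

section PowersOfProducts

theorem mul_pow_of_commute {Q : Type*} [Group Q] {u x z : Q} (hz : x * u = u * x * z)
    (hzu : Commute z u) (hzx : Commute z x) (n : ℕ) :
    (u * x) ^ n = u ^ n * x ^ n * z ^ n.choose 2 := by
  have hswap : ∀ n : ℕ, x ^ n * u = u * x ^ n * z ^ n := by
    intro n
    induction n with
    | zero => simp
    | succ n ih =>
      calc x ^ (n + 1) * u = x ^ n * (x * u) := by rw [pow_succ, mul_assoc]
        _ = (x ^ n * u) * (x * z) := by rw [hz]; simp only [mul_assoc]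
        _ = u * x ^ n * (z ^ n * x) * z := by rw [ih]; simp only [mul_assoc]
        _ = u * x ^ (n + 1) * z ^ (n + 1) := by
          rw [(hzx.pow_left n).eq, pow_succ x, pow_succ z]; simp only [mul_assoc]
  induction n with
  | zero => simp
  | succ n ih =>
    have hc : Commute (z ^ n.choose 2) (u * x) := (hzu.mul_right hzx).pow_left _
    calc (u * x) ^ (n + 1) = u ^ n * x ^ n * (z ^ n.choose 2 * (u * x)) := by
          rw [pow_succ, ih, mul_assoc]
      _ = u ^ n * (x ^ n * u) * x * z ^ n.choose 2 := by rw [hc.eq]; simp only [mul_assoc]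
      _ = u ^ n * u * x ^ n * (z ^ n * x) * z ^ n.choose 2 := by
          rw [hswap]; simp only [mul_assoc]
      _ = u ^ (n + 1) * x ^ (n + 1) * z ^ (n + 1).choose 2 := by
          rw [(hzx.pow_left n).eq, Nat.choose_succ_succ' n 1, Nat.choose_one_right, pow_add z,
            pow_succ u, pow_succ x]
          simp only [mul_assoc]

theorem mul_pow_of_odd {Q : Type*} [Group Q] {u x z : Q} {p : ℕ} (hp : p.Prime) (hodd : Odd p)
    (hz : x * u = u * x * z) (hzu : Commute z u) (hzx : Commute z x) (hzp : z ^ p = 1) :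
    (u * x) ^ p = u ^ p * x ^ p := by
  have hp2 : 2 < p := lt_of_le_of_ne hp.two_le fun h => by subst h; exact absurd hodd (by decide)
  obtain ⟨k, hk⟩ := hp.dvd_choose_self two_ne_zero hp2
  rw [mul_pow_of_commute hz hzu hzx, hk, pow_mul, hzp, one_pow, mul_one]

variable {G : Type*} [Group G] {p : ℕ}

theorem QuotientGroup.mk_mul_pow_of_odd (hp : p.Prime) (hodd : Odd p) {K : Subgroup G} [K.Normal]
    {u x : G} (hc : ⁅x⁻¹, u⁻¹⁆ ∈ K.centralModulo) (hcp : ⁅x⁻¹, u⁻¹⁆ ^ p ∈ K) :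
    (((u * x) ^ p : G) : G ⧸ K) = ((u ^ p * x ^ p : G) : G ⧸ K) := by
  rw [Subgroup.mem_centralModulo] at hc
  have := mul_pow_of_odd (u := (u : G ⧸ K)) (x := (x : G ⧸ K)) (z := ((⁅x⁻¹, u⁻¹⁆ : G) : G ⧸ K))
    hp hodd (by rw [← QuotientGroup.mk_mul, ← QuotientGroup.mk_mul, ← QuotientGroup.mk_mul,
      commutatorElement_def]; congr 1; group)
    (mk_commute_iff.mpr (hc u)) (mk_commute_iff.mpr (hc x))
    (by rw [← QuotientGroup.mk_pow]; exact (QuotientGroup.eq_one_iff _).mpr hcp)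
  exact_mod_cast this

/-- If `M` is generated by central elements and `p`-th powers of elements of `X`, where
`[X, G] ≤ M`, then `M` is powerfully embedded. -/
theorem Subgroup.commutator_le_powers [Group.IsNilpotent G] (hp : p.Prime) (hodd : Odd p)
    {M X : Subgroup G} [M.Normal] (hXM : ⁅X, (⊤ : Subgroup G)⁆ ≤ M)
    (hM : M ≤ X.powers p ⊔ Subgroup.center G) :
    ⁅M, (⊤ : Subgroup G)⁆ ≤ M.powers p := by
  apply Subgroup.le_of_le_sup_commutator
  set K := M.powers p ⊔ ⁅⁅M, (⊤ : Subgroup G)⁆, (⊤ : Subgroup G)⁆ with hK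
  refine le_centralModulo_iff.mp (hM.trans (sup_le ?_ ?_))
  · rw [Subgroup.powers, Subgroup.closure_le]
    rintro _ ⟨x, hx, rfl⟩
    refine mem_centralModulo.mpr fun g => ?_
    rw [← QuotientGroup.mk_commute_iff]
    have hu : ⁅g, x⁆ ∈ M := by
      rw [← commutatorElement_inv]
      exact M.inv_mem (hXM (commutator_mem_commutator hx trivial))
    have hz : ⁅x⁻¹, ⁅g, x⁆⁻¹⁆ ∈ ⁅M, (⊤ : Subgroup G)⁆ := by
      rw [Subgroup.commutator_comm]
      exact commutator_mem_commutator trivial (M.inv_mem hu)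
    have h := QuotientGroup.mk_mul_pow_of_odd hp hodd (K := K) (u := ⁅g, x⁆) (x := x)
      (le_centralModulo_iff.mpr le_sup_right hz)
      (le_sup_left (a := M.powers p) (pow_mem_powers (Subgroup.commutator_le_left M ⊤ hz)))
    have hconj : ⁅g, x⁆ * x = g * x * g⁻¹ := by rw [commutatorElement_def]; group
    rw [hconj, conj_pow, QuotientGroup.mk_mul _ (⁅g, x⁆ ^ p),
      (QuotientGroup.eq_one_iff _).mpr (le_sup_left (a := M.powers p) (pow_mem_powers hu)),
      one_mul, QuotientGroup.mk_mul, QuotientGroup.mk_mul, QuotientGroup.mk_inv,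
      mul_inv_eq_iff_eq_mul] at h
    exact h.symm
  · intro z hz
    refine mem_centralModulo.mpr fun g => ?_
    rw [(show Commute z g from (Subgroup.mem_center_iff.mp hz g).symm).commutator_eq]
    exact K.one_mem

/-- If `N` is powerfully embedded and generated modulo `N ^ p` by `s`, then `N ^ p` is generated
modulo `(N ^ p) ^ p` by the `p`-th powers of the elements of `s`. -/
theorem Subgroup.powers_le_closure_sup (hp : p.Prime) (hodd : Odd p) {N : Subgroup G} [N.Normal]
    (hN : ⁅N, (⊤ : Subgroup G)⁆ ≤ N.powers p)
    (hN' : ⁅N.powers p, (⊤ : Subgroup G)⁆ ≤ (N.powers p).powers p) {s : Set G} (hsN : s ⊆ N)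
    (hs : N ≤ closure s ⊔ N.powers p) :
    N.powers p ≤ closure ((fun x => x ^ p) '' s) ⊔ (N.powers p).powers p := by
  set K := (N.powers p).powers p with hK
  set T := closure ((fun x => x ^ p) '' s) ⊔ K with hT
  have hKT : K ≤ T := le_sup_right
  let S : Subgroup G :=
    { carrier := {x | x ∈ N ∧ x ^ p ∈ T}
      one_mem' := ⟨N.one_mem, by simp⟩
      inv_mem' := fun {x} hx => ⟨N.inv_mem hx.1, by rw [inv_pow]; exact T.inv_mem hx.2⟩
      mul_mem' := fun {u x} hu hx => by
        refine ⟨N.mul_mem hu.1 hx.1, ?_⟩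
        have hc : ⁅x⁻¹, u⁻¹⁆ ∈ N.powers p :=
          hN (commutator_mem_commutator (N.inv_mem hx.1) trivial)
        have h := QuotientGroup.mk_mul_pow_of_odd hp hodd (K := K)
          (le_centralModulo_iff.mpr hN' hc) (pow_mem_powers hc)
        have h' := hKT (QuotientGroup.eq.mp h.symm)
        exact (T.mul_mem_cancel_left (T.inv_mem (T.mul_mem hu.2 hx.2))).mp h' }
  have hNS : N ≤ S := by
    refine hs.trans (sup_le ((closure_le _).mpr fun x hx => ⟨hsN hx, ?_⟩) fun x hx =>
      ⟨N.powers_le p hx, hKT (pow_mem_powers hx)⟩)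
    exact le_sup_left (a := closure _) (subset_closure ⟨x, hx, rfl⟩)
  conv_lhs => rw [Subgroup.powers]
  rw [closure_le]
  rintro _ ⟨x, hx, rfl⟩
  exact (hNS hx).2

end PowersOfProducts

section CyclicProducts

/-- The product set `⟨b₁⟩ ⋯ ⟨bₖ⟩` of the cyclic subgroups generated by the members of a list. -/
def cyclicProduct {G : Type*} [Group G] (l : List G) : Set G :=
  (l.map fun b => (Subgroup.zpowers b : Set G)).prod

theorem one_mem_cyclicProduct {G : Type*} [Group G] (l : List G) : 1 ∈ cyclicProduct l := by
  induction l with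
  | nil => simp [cyclicProduct]
  | cons a l ih =>
    exact Set.mem_mul.mpr ⟨1, (Subgroup.zpowers a).one_mem, 1, ih, mul_one 1⟩

theorem cyclicProduct_append {G : Type*} [Group G] (l₁ l₂ : List G) :
    cyclicProduct (l₁ ++ l₂) = cyclicProduct l₁ * cyclicProduct l₂ := by
  simp [cyclicProduct]

theorem image_cyclicProduct {G Q : Type*} [Group G] [Group Q] (f : G →* Q) (l : List G) :
    f '' cyclicProduct l = cyclicProduct (l.map f) := by
  rw [cyclicProduct, Set.image_list_prod, cyclicProduct, List.map_map, List.map_map]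
  congr 2
  funext b
  exact congrArg SetLike.coe (f.map_zpowers b)

theorem mul_mem_cyclicProduct {Q : Type*} [Group Q] {l : List Q} {x b z : Q}
    (hx : x ∈ cyclicProduct l) (hb : b ∈ l) (hz : z ∈ Subgroup.zpowers b)
    (hzc : z ∈ Subgroup.center Q) : x * z ∈ cyclicProduct l := by
  induction l generalizing x with
  | nil => simp at hb
  | cons a l ih =>
    obtain ⟨y, hy, w, hw, rfl⟩ := Set.mem_mul.mp hx
    rcases List.mem_cons.mp hb with rfl | hb
    · refine Set.mem_mul.mpr ⟨y * z, (Subgroup.zpowers b).mul_mem hy hz, w, hw, ?_⟩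
      rw [mul_assoc, mul_assoc, Subgroup.mem_center_iff.mp hzc w]
    · exact Set.mem_mul.mpr ⟨y, hy, w * z, ih hw hb, (mul_assoc _ _ _).symm⟩

theorem mul_mem_cyclicProduct_of_mem_closure {Q : Type*} [Group Q] {l : List Q} {q : ℕ}
    (hc : ∀ b ∈ l, b ^ q ∈ Subgroup.center Q) {n : Q}
    (hn : n ∈ Subgroup.closure ((fun b => b ^ q) '' {b | b ∈ l})) {x : Q}
    (hx : x ∈ cyclicProduct l) : x * n ∈ cyclicProduct l := by
  induction hn using Subgroup.closure_induction'' generalizing x with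
  | mem z hz =>
    obtain ⟨b, hb, rfl⟩ := hz
    exact mul_mem_cyclicProduct hx hb (Subgroup.npow_mem_zpowers b q) (hc b hb)
  | inv_mem z hz =>
    obtain ⟨b, hb, rfl⟩ := hz
    exact mul_mem_cyclicProduct hx hb (inv_mem (Subgroup.npow_mem_zpowers b q))
      (inv_mem (hc b hb))
  | one => simpa using hx
  | mul y z _ _ hy hz => rw [← mul_assoc]; exact hz (hy hx)

variable {G : Type*} [Group G]

theorem exists_cyclicProduct_inv_mul_mem {K : Subgroup G} [K.Normal] {l : List G} {q : ℕ}
    (hc : ∀ b ∈ l, b ^ q ∈ K.centralModulo) {n y : G}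
    (hn : n ∈ Subgroup.closure ((fun b => b ^ q) '' {b | b ∈ l}) ⊔ K)
    (hy : y ∈ cyclicProduct l) : ∃ y' ∈ cyclicProduct l, y'⁻¹ * (y * n) ∈ K := by
  set f := QuotientGroup.mk' K with hf
  have hn' : f n ∈ Subgroup.closure ((fun b => b ^ q) '' {b | b ∈ l.map f}) := by
    have h := Subgroup.mem_map_of_mem f hn
    rw [Subgroup.map_sup, MonoidHom.map_closure,
      (Subgroup.map_eq_bot_iff _).mpr (QuotientGroup.ker_mk' K).ge, sup_bot_eq] at h
    refine Subgroup.closure_mono ?_ h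
    rintro _ ⟨_, ⟨b, hb, rfl⟩, rfl⟩
    exact ⟨f b, List.mem_map_of_mem hb, (map_pow f b q).symm⟩
  have hyn := mul_mem_cyclicProduct_of_mem_closure (l := l.map f) (q := q) (by
    intro b hb
    obtain ⟨a, ha, rfl⟩ := List.mem_map.mp hb
    rw [← map_pow]
    exact hc a ha) hn' (image_cyclicProduct f l ▸ Set.mem_image_of_mem f hy)
  rw [← image_cyclicProduct, ← map_mul] at hyn
  obtain ⟨y', hy', h⟩ := hyn
  exact ⟨y', hy', QuotientGroup.eq.mp h⟩

variable {p : ℕ}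

/-- A powerfully embedded subgroup generated by a list modulo its `p`-th powers is the product of
the cyclic subgroups generated by the members of that list. -/
theorem subset_cyclicProduct_of_le_closure_sup [Finite G] (hp : p.Prime) (hodd : Odd p)
    (hG : IsPGroup p G) {N : Subgroup G} [N.Normal] (hN : ⁅N, (⊤ : Subgroup G)⁆ ≤ N.powers p)
    {l : List G} (hlN : ∀ b ∈ l, b ∈ N) (hl : N ≤ Subgroup.closure {b | b ∈ l} ⊔ N.powers p) :
    (N : Set G) ⊆ cyclicProduct l := by
  have := Fact.mk hp
  have := hG.isNilpotent
  have key : ∀ j, ((Subgroup.powers p)^[j] N).Normal ∧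
      ⁅(Subgroup.powers p)^[j] N, (⊤ : Subgroup G)⁆ ≤ ((Subgroup.powers p)^[j] N).powers p ∧
      (∀ b ∈ l, b ^ p ^ j ∈ (Subgroup.powers p)^[j] N) ∧
      (Subgroup.powers p)^[j] N ≤ Subgroup.closure ((fun b => b ^ p ^ j) '' {b | b ∈ l}) ⊔
        ((Subgroup.powers p)^[j] N).powers p ∧
      ∀ x ∈ N, ∃ y ∈ cyclicProduct l, y⁻¹ * x ∈ (Subgroup.powers p)^[j] N := by
    intro j
    induction j with
    | zero =>
      refine ⟨‹_›, hN, by simpa using hlN, by simpa using hl, fun x hx => ?_⟩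
      exact ⟨1, one_mem_cyclicProduct l, by simpa using hx⟩
    | succ j ih =>
      rw [Function.iterate_succ_apply']
      generalize (Subgroup.powers p)^[j] N = P at ih ⊢
      obtain ⟨hP, hPc, hPl, hPg, hPy⟩ := ih
      have hPc' : ⁅P.powers p, (⊤ : Subgroup G)⁆ ≤ (P.powers p).powers p :=
        Subgroup.commutator_le_powers hp hodd hPc le_sup_left
      refine ⟨inferInstance, hPc', fun b hb => ?_, ?_, fun x hx => ?_⟩
      · rw [pow_succ, pow_mul]
        exact Subgroup.pow_mem_powers (hPl b hb)
      · have h := Subgroup.powers_le_closure_sup hp hodd hPc hPc' (by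
          rintro _ ⟨b, hb, rfl⟩
          exact hPl b hb) hPg
        rw [Set.image_image] at h
        simpa only [pow_succ, pow_mul] using h
      · obtain ⟨y, hy, hyx⟩ := hPy x hx
        obtain ⟨y', hy', h⟩ := exists_cyclicProduct_inv_mul_mem
          (fun b hb => Subgroup.le_centralModulo_iff.mpr hPc (hPl b hb)) (hPg hyx) hy
        exact ⟨y', hy', by simpa using h⟩
  intro x hx
  obtain ⟨j, hj⟩ := hG.exists_iterate_powers_eq_bot hp N
  obtain ⟨y, hy, h⟩ := (key j).2.2.2.2 x hx
  rw [hj, Subgroup.mem_bot, inv_mul_eq_one] at h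
  exact h ▸ hy

end CyclicProducts

section CommutatorList

variable {G : Type*} [Group G]

/-- The commutators `⁅lᵢ, lⱼ⁆` with `i < j`. -/
def commutatorList : List G → List G
  | [] => []
  | a :: l => l.map (fun b => ⁅a, b⁆) ++ commutatorList l

theorem two_mul_length_commutatorList_add (l : List G) :
    2 * (commutatorList l).length + l.length = l.length * l.length := by
  induction l with
  | nil => rfl
  | cons a l ih =>
    simp only [commutatorList, List.length_append, List.length_map, List.length_cons]
    linarith

theorem mem_commutator_of_mem_commutatorList {l : List G} {c : G} (hc : c ∈ commutatorList l) :
    c ∈ commutator G := by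
  induction l with
  | nil => simp [commutatorList] at hc
  | cons a l ih =>
    rcases List.mem_append.mp hc with h | h
    · obtain ⟨b, -, rfl⟩ := List.mem_map.mp h
      exact Subgroup.commutator_mem_commutator trivial trivial
    · exact ih h

theorem commutatorElement_mem_of_commutatorList {l : List G} {T : Subgroup G}
    (hT : ∀ c ∈ commutatorList l, c ∈ T) {a b : G} (ha : a ∈ l) (hb : b ∈ l) : ⁅a, b⁆ ∈ T := by
  induction l with
  | nil => simp at ha
  | cons x l ih =>
    have hx : ∀ y ∈ l, ⁅x, y⁆ ∈ T := fun y hy =>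
      hT _ (List.mem_append_left _ (List.mem_map_of_mem hy))
    rcases List.mem_cons.mp ha with rfl | ha' <;> rcases List.mem_cons.mp hb with rfl | hb'
    · simp
    · exact hx b hb'
    · rw [← commutatorElement_inv]
      exact T.inv_mem (hx a ha')
    · exact ih (fun c hc => hT c (List.mem_append_right _ hc)) ha' hb'

theorem commutator_le_of_commutatorList {l : List G} (hl : Subgroup.closure {b | b ∈ l} = ⊤)
    {T : Subgroup G} [T.Normal] (hT : ∀ c ∈ commutatorList l, c ∈ T) : commutator G ≤ T := by
  have hcl : ∀ a ∈ l, a ∈ T.centralModulo := by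
    intro a ha
    refine Subgroup.mem_centralModulo.mpr fun g => ?_
    have hg : g ∈ Subgroup.closure {b | b ∈ l} := hl ▸ Subgroup.mem_top g
    rw [← QuotientGroup.mk_commute_iff]
    have hle : Subgroup.closure {b | b ∈ l} ≤
        (Subgroup.centralizer {(a : G ⧸ T)}).comap (QuotientGroup.mk' T) := by
      rw [Subgroup.closure_le]
      intro b hb
      refine Subgroup.mem_centralizer_singleton_iff.mpr ?_
      exact (QuotientGroup.mk_commute_iff.mpr
        (commutatorElement_mem_of_commutatorList hT hb ha)).eq
    exact (show Commute (g : G ⧸ T) a from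
      Subgroup.mem_centralizer_singleton_iff.mp (hle hg)).symm
  have htop : (⊤ : Subgroup G) ≤ T.centralModulo := by
    rw [← hl, Subgroup.closure_le]
    exact hcl
  exact Subgroup.le_centralModulo_iff.mp htop

theorem commutator_le_closure_commutatorList_sup {l : List G}
    (hl : Subgroup.closure {b | b ∈ l} = ⊤) {K : Subgroup G} [K.Normal]
    (hK : ⁅commutator G, (⊤ : Subgroup G)⁆ ≤ K) :
    commutator G ≤ Subgroup.closure {c | c ∈ commutatorList l} ⊔ K := by
  set T := Subgroup.closure {c | c ∈ commutatorList l} ⊔ K with hT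
  have hTK : T ≤ K.centralModulo := by
    refine sup_le ((Subgroup.closure_le _).mpr fun c hc => ?_) Subgroup.le_centralModulo_self
    exact Subgroup.le_centralModulo_iff.mpr hK (mem_commutator_of_mem_commutatorList hc)
  have : T.Normal := by
    refine ⟨fun x hx g => ?_⟩
    have h : ⁅x, g⁆ ∈ T := le_sup_right (a := Subgroup.closure _)
      (Subgroup.mem_centralModulo.mp (hTK hx) g)
    have : g * x * g⁻¹ = ⁅x, g⁆⁻¹ * x := by rw [commutatorElement_def]; group
    rw [this]
    exact T.mul_mem (T.inv_mem h) hx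
  exact commutator_le_of_commutatorList hl fun c hc =>
    le_sup_left (a := Subgroup.closure _) (Subgroup.subset_closure hc)

end CommutatorList

theorem IsQuasiPowerful.commutator_le {p : ℕ} {G : Type*} [Group G] (h : IsQuasiPowerful p G) :
    commutator G ≤ (⊤ : Subgroup G).powers p ⊔ Subgroup.center G := by
  set f := QuotientGroup.mk' (Subgroup.center G) with hf
  have hpow : powSubgroup (G ⧸ Subgroup.center G) p ≤ ((⊤ : Subgroup G).powers p).map f := by
    rw [powSubgroup, Subgroup.closure_le]
    rintro _ ⟨g, rfl⟩
    obtain ⟨g, rfl⟩ := QuotientGroup.mk'_surjective _ g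
    exact ⟨g ^ p, Subgroup.pow_mem_powers trivial, map_pow f g p⟩
  have hcomm : (commutator G).map f ≤ commutator (G ⧸ Subgroup.center G) := by
    rw [commutator_def, Subgroup.map_commutator]
    exact Subgroup.commutator_mono le_top le_top
  have := Subgroup.map_le_iff_le_comap.mp (hcomm.trans (h.trans hpow))
  rwa [Subgroup.comap_map_eq, hf, QuotientGroup.ker_mk'] at this

theorem product_of_cyclic_subgroups (p : ℕ) (hp : p.Prime) (hodd : Odd p)
    (G : Type*) [Group G] [Finite G]
    (hG : IsPGroup p G) (hQP : IsQuasiPowerful p G) (d : ℕ) (hd : Group.rank G = d) :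
    ∃ (k : ℕ) (H : Fin k → Subgroup G), k ≤ d + d * (d + 3) / 2 ∧
      (∀ i, IsCyclic (H i)) ∧
      ∀ g : G, ∃ h : (i : Fin k) → G, (∀ i, h i ∈ H i) ∧ g = (List.ofFn h).prod := by
  have := Fact.mk hp
  have := hG.isNilpotent
  obtain ⟨S, hS, hSG⟩ := Group.rank_spec G
  set l := S.toList with hl
  have hlen : l.length = d := by rw [hl, Finset.length_toList, hS, hd]
  have hlG : Subgroup.closure {b | b ∈ l} = ⊤ := by
    rw [← hSG]
    congr 1
    ext b
    simp [hl]
  have hpe : ⁅commutator G, (⊤ : Subgroup G)⁆ ≤ (commutator G).powers p :=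
    Subgroup.commutator_le_powers hp hodd le_rfl hQP.commutator_le
  have hcomm : (commutator G : Set G) ⊆ cyclicProduct (commutatorList l) :=
    subset_cyclicProduct_of_le_closure_sup hp hodd hG hpe
      (fun c hc => mem_commutator_of_mem_commutatorList hc)
      (commutator_le_closure_commutatorList_sup hlG hpe)
  have hall : ∀ g, g ∈ cyclicProduct (l ++ commutatorList l) := by
    intro g
    obtain ⟨y, hy, h⟩ := exists_cyclicProduct_inv_mul_mem (K := commutator G) (l := l) (q := 1)
      (fun b _ => Subgroup.mem_centralModulo.mpr fun g =>
        Subgroup.commutator_mem_commutator trivial trivial) (n := g)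
      (by simp [hlG]) (one_mem_cyclicProduct l)
    rw [cyclicProduct_append]
    exact Set.mem_mul.mpr ⟨y, hy, _, hcomm h, by group⟩
  set L := l ++ commutatorList l with hL
  refine ⟨L.length, fun i => Subgroup.zpowers (L.get i), ?_, fun i => inferInstance, fun g => ?_⟩
  · have h := two_mul_length_commutatorList_add l
    rw [hlen] at h
    have h2 : (commutatorList l).length ≤ d * (d + 3) / 2 := by
      rw [Nat.le_div_iff_mul_le two_pos]
      nlinarith
    rw [hL, List.length_append, hlen]
    omega
  · have h := hall g
    have hofFn : L.map (fun b => (Subgroup.zpowers b : Set G)) =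
        List.ofFn fun i => (Subgroup.zpowers (L.get i) : Set G) := by
      conv_lhs => rw [← List.ofFn_get L, List.map_ofFn]
      rfl
    rw [cyclicProduct, hofFn, Set.mem_prod_list_ofFn] at h
    obtain ⟨f, hf⟩ := h
    exact ⟨fun i => f i, fun i => (f i).2, hf.symm⟩
end
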